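/- Let (T, μ, η) be an idempotent monad on a category 𝕏 with finite biproducts. Then (T, μ, η) is a Hopf monad if and only if for all pairs of objects A, B of 𝕏 the equality T(1_A ⊕ 0) + T(0 ⊕ 1_{T(B)}) = 1_{T(A ⊕ T(B))} holds, where 0 denotes the appropriate zero endomorphisms of T(B) and A respectively. -/

import Mathlib

/-!
Hopf monads on a category with finite biproducts (Bruguières–Lack–Virelizier style),
following "Hopf Monads on Biproducts".

Setting: `C` is a category with a zero object and binary biproducts (hence zero
morphisms), so that each hom-set carries the commutative monoid structure induced by
the biproducts.  `badd f g` is the induced addition of parallel maps.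
-/

namespace HopfBiproducts

open CategoryTheory CategoryTheory.Limits ZeroObject

universe v u

variable {C : Type u} [Category.{v} C] [HasZeroObject C] [HasZeroMorphisms C]
  [HasBinaryBiproducts C]

/-- The addition of parallel maps induced by binary biproducts:
`f + g = ⟨f, g⟩ ≫ [1, 1]`. -/
noncomputable def badd {X Y : C} (f g : X ⟶ Y) : X ⟶ Y :=
  biprod.lift f g ≫ biprod.desc (𝟙 Y) (𝟙 Y)

/-- The fusion operator `h_{A,B} = ι₁ ∘ T(π₁) + ι₂ ∘ μ_B ∘ T(π₂)` of a monad on a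
category with finite biproducts. -/
noncomputable def fusion (T : Monad C) (A B : C) :
    T.obj (A ⊞ T.obj B) ⟶ T.obj A ⊞ T.obj B :=
  badd (T.map biprod.fst ≫ biprod.inl) (T.map biprod.snd ≫ T.μ.app B ≫ biprod.inr)


section Addition

omit [HasZeroObject C]

theorem comp_badd {X Y Z : C} (f : X ⟶ Y) (g h : Y ⟶ Z) :
    f ≫ badd g h = badd (f ≫ g) (f ≫ h) := by
  have e : f ≫ biprod.lift g h = biprod.lift (f ≫ g) (f ≫ h) := by ext <;> simp
  simp only [badd, ← e, Category.assoc]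

theorem badd_comp {X Y Z : C} (g h : X ⟶ Y) (f : Y ⟶ Z) :
    badd g h ≫ f = badd (g ≫ f) (h ≫ f) := by
  have e : biprod.lift (g ≫ f) (h ≫ f) = biprod.lift g h ≫ biprod.map f f := by ext <;> simp
  have e' : biprod.map f f ≫ biprod.desc (𝟙 Z) (𝟙 Z) = biprod.desc (𝟙 Y) (𝟙 Y) ≫ f := by
    ext <;> simp
  simp only [badd, e, Category.assoc, e']

@[simp]
theorem badd_zero {X Y : C} (f : X ⟶ Y) : badd f 0 = f := by
  have e : biprod.lift f (0 : X ⟶ Y) = f ≫ biprod.inl := by ext <;> simp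
  simp [badd, e]

@[simp]
theorem zero_badd {X Y : C} (f : X ⟶ Y) : badd 0 f = f := by
  have e : biprod.lift (0 : X ⟶ Y) f = f ≫ biprod.inr := by ext <;> simp
  simp [badd, e]

theorem fusion_fst (T : Monad C) (A B : C) :
    fusion T A B ≫ biprod.fst = T.map biprod.fst := by
  simp [fusion, badd_comp]

theorem fusion_snd (T : Monad C) (A B : C) :
    fusion T A B ≫ biprod.snd = T.map biprod.snd ≫ T.μ.app B := by
  simp [fusion, badd_comp]

/-- The candidate inverse `[T(ι₁), T(ι₂) ∘ η_{T(B)}]` of the fusion operator of an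
idempotent monad. -/
noncomputable def fusionInv (T : Monad C) (A B : C) :
    T.obj A ⊞ T.obj B ⟶ T.obj (A ⊞ T.obj B) :=
  biprod.desc (T.map biprod.inl) (T.η.app (T.obj B) ≫ T.map biprod.inr)

omit [HasZeroMorphisms C] [HasBinaryBiproducts C] in
/-- For an idempotent monad, `η_{T(B)}` is the two-sided inverse of `μ_B`. -/
theorem mu_comp_eta (T : Monad C) (B : C) [IsIso (T.μ.app B)] :
    T.μ.app B ≫ T.η.app (T.obj B) = 𝟙 _ := by
  rw [← cancel_mono (T.μ.app B)]
  simp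

theorem fusion_comp_fusionInv (T : Monad C) (A B : C) [IsIso (T.μ.app B)] :
    fusion T A B ≫ fusionInv T A B =
      badd (T.map (biprod.map (𝟙 A) (0 : T.obj B ⟶ T.obj B)))
        (T.map (biprod.map (0 : A ⟶ A) (𝟙 (T.obj B)))) := by
  have e₁ : biprod.map (𝟙 A) (0 : T.obj B ⟶ T.obj B) = biprod.fst ≫ biprod.inl := by
    ext <;> simp
  have e₂ : biprod.map (0 : A ⟶ A) (𝟙 (T.obj B)) = biprod.snd ≫ biprod.inr := by
    ext <;> simp
  rw [fusion, badd_comp, e₁, e₂]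
  simp only [fusionInv, Category.assoc, biprod.inl_desc, biprod.inr_desc, Functor.map_comp]
  rw [← Category.assoc (T.μ.app B), mu_comp_eta, Category.id_comp]

end Addition

section ZeroMap

omit [HasBinaryBiproducts C]

/-- An idempotent monad preserves the zero object. -/
theorem id_map_zero_eq_zero (T : Monad C) [IsIso (T.μ.app (0 : C))] :
    𝟙 (T.obj (0 : C)) = 0 := by
  have hη : T.η.app (T.obj 0) = T.map (T.η.app (0 : C)) := by
    rw [← cancel_mono (T.μ.app (0 : C))]
    simp
  have hn := T.η.naturality (0 : T.obj (0 : C) ⟶ 0)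
  have hid : T.η.app (0 : C) ≫ (0 : T.obj (0 : C) ⟶ 0) = 𝟙 0 := Subsingleton.elim _ _
  simp only [Functor.id_map, zero_comp] at hn
  rw [hη, ← Functor.map_comp, hid] at hn
  exact (T.toFunctor.map_id 0).symm.trans hn.symm

/-- An idempotent monad preserves zero maps. -/
theorem map_zero_eq_zero (T : Monad C) [IsIso (T.μ.app (0 : C))] (A B : C) :
    T.map (0 : A ⟶ B) = 0 := by
  have e : (0 : A ⟶ B) = (0 : A ⟶ 0) ≫ 𝟙 0 ≫ (0 : 0 ⟶ B) := by simp
  rw [e, Functor.map_comp, Functor.map_comp, CategoryTheory.Functor.map_id, id_map_zero_eq_zero]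
  simp

end ZeroMap

theorem fusionInv_comp_fusion (T : Monad C) (A B : C) [IsIso (T.μ.app (0 : C))] :
    fusionInv T A B ≫ fusion T A B = 𝟙 _ := by
  ext <;>
    simp only [fusionInv, Category.assoc, fusion_fst, fusion_snd, biprod.inl_desc_assoc,
      biprod.inr_desc_assoc, ← Functor.map_comp, ← Functor.map_comp_assoc, biprod.inl_fst,
      biprod.inl_snd, biprod.inr_fst, biprod.inr_snd, map_zero_eq_zero] <;>
    simp

/-- an idempotent monad on a category with finite biproducts is a Hopf
monad if and only if `T(1_A ⊕ 0) + T(0 ⊕ 1_{T(B)}) = 1_{T(A ⊕ T(B))}` for all `A, B`. -/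
theorem isHopf_iff_of_idempotent (T : Monad C) (hidem : ∀ A : C, IsIso (T.μ.app A)) :
    (∀ A B : C, IsIso (fusion T A B)) ↔
      (∀ A B : C,
        badd (T.map (biprod.map (𝟙 A) (0 : T.obj B ⟶ T.obj B)))
            (T.map (biprod.map (0 : A ⟶ A) (𝟙 (T.obj B)))) =
          𝟙 (T.obj (A ⊞ T.obj B))) := by
  constructor
  · intro h A B
    rw [← fusion_comp_fusionInv, ← cancel_mono (fusion T A B), Category.assoc,
      fusionInv_comp_fusion, Category.comp_id, Category.id_comp]
  · intro h A B
    exact ⟨fusionInv T A B, (fusion_comp_fusionInv T A B).trans (h A B),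
      fusionInv_comp_fusion T A B⟩

end HopfBiproducts
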